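/- arXiv:2109.08576 — 5 statements merged into one kernel-verified Lean document; each statement's English description precedes it below -/
import Mathlib

section
/- Define H : ℝ × [0,1] → ℝ by H(x,t) = t·x. Then for every t ∈ [0,1] the map x ↦ t·x is uniformly continuous, and for every x ∈ ℝ the map t ↦ t·x is uniformly continuous; nevertheless H itself is NOT uniformly continuous with respect to the product uniformity on ℝ × [0,1]. (In other words, a homotopy through uniformly continuous maps need not be uniformly continuous.) -/
/-- The scaling homotopy `H(x,t) = t·x` on `ℝ × [0,1]` is a homotopy through
uniformly continuous maps (each slice in either variable is uniformly continuous),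
yet `H` itself is not uniformly continuous for the product uniformity. -/
theorem scaling_homotopy_slices_uniform_but_not_uniform :
    (∀ t : unitInterval, UniformContinuous fun x : ℝ => (t : ℝ) * x) ∧
    (∀ x : ℝ, UniformContinuous fun t : unitInterval => (t : ℝ) * x) ∧
    ¬ UniformContinuous (fun p : ℝ × unitInterval => (p.2 : ℝ) * p.1) := by
  refine ⟨fun t => uniformContinuous_const_smul (t : ℝ), fun x => ?_, fun h => ?_⟩
  · simpa only [smul_eq_mul, mul_comm x, Function.comp_def] using
      (uniformContinuous_const_smul (X := ℝ) x).comp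
        (uniformContinuous_subtype_val (p := fun t : ℝ => t ∈ unitInterval))
  · obtain ⟨δ, hδ, hH⟩ := Metric.uniformContinuous_iff.1 h 1 one_pos
    obtain ⟨t, ht, htδ⟩ := exists_between (lt_min hδ one_pos)
    obtain ⟨htδ, ht1⟩ := lt_min_iff.1 htδ
    have hd := hH (a := (t⁻¹, ⟨t, ht.le, ht1.le⟩)) (b := (t⁻¹, 0)) (by
      simpa [Prod.dist_eq, Subtype.dist_eq, abs_of_pos ht, hδ] using htδ)
    simp [ht.ne'] at hd
end

section
/- There is no uniformly continuous map H : ℝ × [0,1] → ℝ such that H(x,0) = x for all x ∈ ℝ and H(·,1) is a constant map (i.e., H(x,1) = H(y,1) for all x,y ∈ ℝ). Consequently the identity map of ℝ is not uniformly homotopic to a constant map, so the unique map from the metric space ℝ to the one-point space is not a uniform homotopy equivalence. -/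
/-- The endpoints of a uniform homotopy stay at bounded distance from each other. -/
theorem UniformContinuous.exists_dist_homotopy_endpoints_le {X Y : Type*}
    [PseudoMetricSpace X] [PseudoMetricSpace Y] {H : X × unitInterval → Y}
    (hH : UniformContinuous H) : ∃ C : ℝ, ∀ x, dist (H (x, 0)) (H (x, 1)) ≤ C := by
  obtain ⟨δ, hδ, hHδ⟩ := Metric.uniformContinuous_iff.1 hH 1 one_pos
  obtain ⟨n, hn⟩ := exists_nat_one_div_lt hδ
  have hn0 : (0 : ℝ) < n + 1 := by positivity
  let t : ℕ → unitInterval := fun k ↦ Set.projIcc 0 1 zero_le_one ((k : ℝ) / (n + 1))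
  have ht0 : t 0 = 0 := by simp [t]
  have ht1 : t (n + 1) = 1 := by simp [t, div_self hn0.ne']
  have ht (k : ℕ) : dist (t k) (t (k + 1)) < δ := by
    refine lt_of_le_of_lt ?_ hn
    refine ((LipschitzWith.projIcc zero_le_one).dist_le_mul _ _).trans_eq ?_
    rw [NNReal.coe_one, one_mul, dist_comm, Real.dist_eq, ← sub_div]
    push_cast
    rw [add_sub_cancel_left, abs_of_pos (by positivity)]
  refine ⟨∑ _k ∈ Finset.range (n + 1), 1, fun x ↦ ?_⟩
  have h := dist_le_range_sum_of_dist_le (f := fun k ↦ H (x, t k)) (d := fun _ ↦ 1) (n + 1)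
    fun {k} _ ↦ (hHδ (a := (x, t k)) (b := (x, t (k + 1))) (by simp [Prod.dist_eq, ht k])).le
  simpa only [ht0, ht1] using h

/-- There is no uniformly continuous map `H : ℝ × [0,1] → ℝ` with `H(x,0) = x`
for all `x` and `H(·,1)` constant; i.e. the identity of `ℝ` is not uniformly
homotopic to a constant map, so `ℝ → ⋆` is not a uniform homotopy equivalence. -/
theorem no_uniform_contraction_of_real_line :
    ¬ ∃ H : ℝ × unitInterval → ℝ,
        UniformContinuous H ∧
        (∀ x : ℝ, H (x, 0) = x) ∧
        (∀ x y : ℝ, H (x, 1) = H (y, 1)) := by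
  rintro ⟨H, hH, h0, h1⟩
  obtain ⟨C, hC⟩ := hH.exists_dist_homotopy_endpoints_le
  have hx := hC (H (0, 1) + |C| + 1)
  rw [h0, h1 (H (0, 1) + |C| + 1) 0, Real.dist_eq] at hx
  have := le_abs_self (H (0, 1) + |C| + 1 - H (0, 1))
  linarith [le_abs_self C]
end

section
/- Let X be a pseudometric space, E a real normed vector space, K, D nonnegative real constants, and f, g : X → E two K-Lipschitz maps such that ‖g(x) − f(x)‖ ≤ D for all x ∈ X. Then the straight-line homotopy H : X × [0,1] → E defined by H(x,t) = f(x) + t·(g(x) − f(x)) is (K + D)-Lipschitz with respect to the sup metric on X × [0,1]. -/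
open scoped NNReal

/-- If `f g : X → E` are `K`-Lipschitz maps into a real normed vector space with
`‖g x − f x‖ ≤ D` for all `x`, then the straight-line homotopy
`H(x,t) = f x + t • (g x − f x)` is `(K + D)`-Lipschitz for the sup metric on
`X × [0,1]`. -/
theorem straight_line_homotopy_lipschitz
    {X : Type*} [PseudoMetricSpace X] {E : Type*} [NormedAddCommGroup E]
    [NormedSpace ℝ E] (K D : ℝ≥0) (f g : X → E)
    (hf : LipschitzWith K f) (hg : LipschitzWith K g)
    (hfg : ∀ x : X, ‖g x - f x‖ ≤ D) :
    LipschitzWith (K + D)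
      (fun p : X × unitInterval => f p.1 + (p.2 : ℝ) • (g p.1 - f p.1)) := by
  refine LipschitzWith.of_dist_le_mul ?_
  rintro ⟨x, t⟩ ⟨y, s⟩
  have ht₀ : (0 : ℝ) ≤ t := t.2.1
  have ht₁ : (0 : ℝ) ≤ 1 - t := sub_nonneg.2 t.2.2
  set d := dist (x, t) (y, s)
  have hx : dist x y ≤ d := le_max_left _ _
  have hts : |(t : ℝ) - s| ≤ d := le_max_right (dist x y) (dist t s)
  have hfd : ‖f x - f y‖ ≤ K * d := by
    rw [← dist_eq_norm]
    exact (hf.dist_le_mul x y).trans (by gcongr)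
  have hgd : ‖g x - g y‖ ≤ K * d := by
    rw [← dist_eq_norm]
    exact (hg.dist_le_mul x y).trans (by gcongr)
  have key : f x + (t : ℝ) • (g x - f x) - (f y + (s : ℝ) • (g y - f y)) =
      (1 - t : ℝ) • (f x - f y) + (t : ℝ) • (g x - g y) + (t - s : ℝ) • (g y - f y) := by
    module
  rw [dist_eq_norm, key]
  calc _ ≤ ‖(1 - t : ℝ) • (f x - f y)‖ + ‖(t : ℝ) • (g x - g y)‖
        + ‖(t - s : ℝ) • (g y - f y)‖ := norm_add₃_le
    _ = (1 - t) * ‖f x - f y‖ + t * ‖g x - g y‖ + |(t : ℝ) - s| * ‖g y - f y‖ := by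
      rw [norm_smul_of_nonneg ht₁, norm_smul_of_nonneg ht₀, norm_smul, Real.norm_eq_abs]
    _ ≤ (1 - t) * (K * d) + t * (K * d) + d * D := by
      gcongr
      exact hfg y
    _ = ↑(K + D) * d := by
      push_cast
      ring
end

section
/- Let X be a uniform space, E a real normed vector space, and f, g : X → E uniformly continuous maps such that there exists D ≥ 0 with ‖g(x) − f(x)‖ ≤ D for all x ∈ X. Then the straight-line homotopy H : X × [0,1] → E defined by H(x,t) = f(x) + t·(g(x) − f(x)) is uniformly continuous with respect to the product uniformity on X × [0,1]. -/
/-- The pointwise scalar product of bounded uniformly continuous maps is uniformly continuous. -/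
theorem UniformContinuous.smul_of_norm_le {Y 𝕜 E : Type*} [UniformSpace Y] [NormedField 𝕜]
    [SeminormedAddCommGroup E] [NormedSpace 𝕜 E] {c : Y → 𝕜} {h : Y → E}
    (hc : UniformContinuous c) (hh : UniformContinuous h) {C D : ℝ}
    (hC : ∀ y, ‖c y‖ ≤ C) (hD : ∀ y, ‖h y‖ ≤ D) :
    UniformContinuous fun y => c y • h y := by
  have hc' := tendsto_uniformity_iff_dist_tendsto_zero.1 hc
  have hh' := tendsto_uniformity_iff_dist_tendsto_zero.1 hh
  refine tendsto_uniformity_iff_dist_tendsto_zero.2 (squeeze_zero (fun _ => dist_nonneg)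
    (g := fun p : Y × Y => C * dist (h p.1) (h p.2) + dist (c p.1) (c p.2) * D) ?_ ?_)
  · rintro ⟨x, y⟩
    calc dist (c x • h x) (c y • h y)
        = ‖c x • (h x - h y) + (c x - c y) • h y‖ := by
          rw [dist_eq_norm, smul_sub, sub_smul, sub_add_sub_cancel]
      _ ≤ ‖c x‖ * ‖h x - h y‖ + ‖c x - c y‖ * ‖h y‖ := by
          simpa only [norm_smul] using norm_add_le (c x • (h x - h y)) ((c x - c y) • h y)
      _ ≤ C * dist (h x) (h y) + dist (c x) (c y) * D := by
          rw [dist_eq_norm, dist_eq_norm]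
          gcongr
          exacts [hC x, hD y]
  · simpa using (hh'.const_mul C).add (hc'.mul_const D)

/-- If `f g : X → E` are uniformly continuous maps from a uniform space into a real
normed vector space that are uniformly close (`‖g x − f x‖ ≤ D` for all `x`), then
the straight-line homotopy `H(x,t) = f x + t • (g x − f x)` is uniformly continuous
for the product uniformity on `X × [0,1]`. -/
theorem straight_line_homotopy_uniformContinuous
    {X : Type*} [UniformSpace X] {E : Type*} [NormedAddCommGroup E]
    [NormedSpace ℝ E] (f g : X → E)
    (hf : UniformContinuous f) (hg : UniformContinuous g)
    (D : ℝ) (hD : 0 ≤ D) (hfg : ∀ x : X, ‖g x - f x‖ ≤ D) :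
    UniformContinuous
      (fun p : X × unitInterval => f p.1 + (p.2 : ℝ) • (g p.1 - f p.1)) := by
  have hgf : UniformContinuous fun x => g x - f x := hg.sub hf
  have ht : UniformContinuous fun p : X × unitInterval => (p.2 : ℝ) :=
    uniformContinuous_subtype_val.comp uniformContinuous_snd
  refine (hf.comp uniformContinuous_fst).add
    (ht.smul_of_norm_le (C := 1) (hgf.comp uniformContinuous_fst) (fun p => ?_)
      fun p => hfg p.1)
  rw [Real.norm_of_nonneg p.2.2.1]
  exact p.2.2.2
end

section
/- Let Y be a pseudometric space and (Y_i)_{i ∈ ℕ} a monotone increasing family of subsets of Y such that for every i, every y ∈ Y_i, and every z ∈ Y with dist(y, z) < 1, one has z ∈ Y_{i+1}. Let L ≥ 0, let n be a natural number, and let f : [0,1]ⁿ → Y be an L-Lipschitz map (where [0,1]ⁿ carries the sup metric). If f(x₀) ∈ Y_{i₀} for some point x₀ ∈ [0,1]ⁿ, then the entire range of f is contained in Y_{i₀ + ⌊L⌋ + 1}. -/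
open scoped NNReal

/-- Let `(Yᵢ)` be a monotone family of subsets of a pseudometric space `Y` such that
the `1`-neighborhood of `Yᵢ` is contained in `Y_{i+1}`.  Any `L`-Lipschitz map
`f : [0,1]ⁿ → Y` (sup metric on the cube) sending some point into `Y_{i₀}` has its
entire range inside `Y_{i₀ + ⌊L⌋ + 1}`. -/
theorem lipschitz_cube_image_in_finite_stage
    {Y : Type*} [PseudoMetricSpace Y] (Yi : ℕ → Set Y) (hmono : Monotone Yi)
    (hsep : ∀ i : ℕ, ∀ y ∈ Yi i, ∀ z : Y, dist y z < 1 → z ∈ Yi (i + 1))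
    (L : ℝ≥0) (n : ℕ) (f : (Fin n → unitInterval) → Y) (hf : LipschitzWith L f)
    (i₀ : ℕ) (x₀ : Fin n → unitInterval) (hx₀ : f x₀ ∈ Yi i₀) :
    ∀ x : Fin n → unitInterval, f x ∈ Yi (i₀ + ⌊(L : ℝ)⌋₊ + 1) := by
  intro x
  set N : ℕ := ⌊(L : ℝ)⌋₊ + 1 with hN
  have hLN : (L : ℝ) < N := by
    rw [hN]
    push_cast
    exact Nat.lt_floor_add_one _
  have hNpos : (0 : ℝ) < N := L.coe_nonneg.trans_lt hLN
  -- subdivide the segment from `x₀` to `x` into `N` equal steps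
  let p : ℕ → Fin n → unitInterval := fun k j =>
    Set.projIcc 0 1 zero_le_one ((x₀ j : ℝ) + (k / N : ℝ) * ((x j : ℝ) - x₀ j))
  have hp_zero : p 0 = x₀ := by
    funext j
    simp [p]
  have hp_last : p N = x := by
    funext j
    simp [p]
  have hp_step (k : ℕ) : dist (p k) (p (k + 1)) ≤ 1 / N := by
    refine (dist_pi_le_iff (by positivity)).2 fun j => ?_
    refine ((LipschitzWith.projIcc zero_le_one).dist_le_mul _ _).trans ?_
    have hdiff : |(x j : ℝ) - x₀ j| ≤ 1 :=
      abs_le.2 ⟨by linarith [(x j).2.1, (x₀ j).2.2], by linarith [(x j).2.2, (x₀ j).2.1]⟩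
    rw [NNReal.coe_one, one_mul, dist_comm, Real.dist_eq]
    have heq : (x₀ j : ℝ) + ((k + 1 : ℕ) / N : ℝ) * ((x j : ℝ) - x₀ j)
        - (x₀ j + (k / N : ℝ) * ((x j : ℝ) - x₀ j)) = 1 / N * ((x j : ℝ) - x₀ j) := by
      push_cast
      ring
    rw [heq, abs_mul, abs_of_pos (by positivity)]
    exact mul_le_of_le_one_right (by positivity) hdiff
  have hmem (k : ℕ) : f (p k) ∈ Yi (i₀ + k) := by
    induction k with
    | zero => simpa [hp_zero] using hx₀
    | succ k ih =>
      refine hsep _ _ ih _ ?_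
      calc dist (f (p k)) (f (p (k + 1))) ≤ L * dist (p k) (p (k + 1)) := hf.dist_le_mul _ _
        _ ≤ L * (1 / N) := by gcongr; exact hp_step k
        _ < 1 := by rwa [mul_one_div, div_lt_one hNpos]
  rw [add_assoc, ← hN, ← hp_last]
  exact hmem N
end
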